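/- arXiv:1509.08373 — 2 statements merged into one kernel-verified Lean document; each statement's English description precedes it below -/
import Mathlib

section
/- Let Φ : ℝ^N → ℝ be a convex differentiable function, and let ℝ^N be decomposed into n blocks of dimensions N_1,…,N_n (with N_1+⋯+N_n = N) via matrices U_i ∈ ℝ^{N×N_i} forming a column permutation of the identity, so that every y ∈ ℝ^N is uniquely written y = Σ_i U_i y_i with y_i = U_iᵀ y. Assume ∇Φ is block coordinate-wise Lipschitz continuous with positive constants L_1,…,L_n, i.e., ‖∇_i Φ(y + U_i s_i) − ∇_i Φ(y)‖ ≤ L_i ‖s_i‖ for all y ∈ ℝ^N and s_i ∈ ℝ^{N_i}, where ∇_i Φ(y) = U_iᵀ ∇Φ(y). Let W be the block-diagonal matrix whose i-th diagonal block is w_i I_{N_i} with 0 < w_i ≤ 1/(n L_i). Then for all y, s ∈ ℝ^N it holds that Φ(y + s) ≤ Φ(y) + ⟨s, ∇Φ(y)⟩ + (1/2)‖s‖²_{W⁻¹}. -/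
open scoped RealInnerProductSpace BigOperators

noncomputable section

/-- If the directional derivative of `f` along the segment from `y` to `y + h` grows at most
linearly with slope `C`, then `f` is bounded at `y + h` by its quadratic model. -/
lemma le_add_inner_gradient_add_of_inner_gradient_sub_le {E : Type*} [NormedAddCommGroup E]
    [InnerProductSpace ℝ E] [CompleteSpace E] {f : E → ℝ} (hf : Differentiable ℝ f) {y h : E}
    {C : ℝ} (hC : ∀ t ∈ Set.Ioo (0 : ℝ) 1,
      ⟪h, gradient f (y + t • h) - gradient f y⟫ ≤ C * t) :
    f (y + h) ≤ f y + ⟪h, gradient f y⟫ + C / 2 := by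
  have hline : ∀ t : ℝ, HasDerivAt (fun t : ℝ => f (y + t • h))
      ⟪h, gradient f (y + t • h)⟫ t := by
    intro t
    have h1 := (hf (y + t • h)).hasGradientAt.hasFDerivAt
    have h2 : HasDerivAt (fun t : ℝ => y + t • h) h t := by
      simpa using ((hasDerivAt_id t).smul_const h).const_add y
    have h3 := h1.comp_hasDerivAt t h2
    rw [InnerProductSpace.toDual_apply_apply, real_inner_comm] at h3
    exact h3
  have hder : ∀ t : ℝ, HasDerivAt
      (fun t : ℝ => f (y + t • h) - t * ⟪h, gradient f y⟫ - C / 2 * t ^ 2)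
      (⟪h, gradient f (y + t • h)⟫ - ⟪h, gradient f y⟫ - C * t) t := by
    intro t
    have h1 := ((hline t).sub ((hasDerivAt_id t).mul_const ⟪h, gradient f y⟫)).sub
      ((hasDerivAt_pow 2 t).const_mul (C / 2))
    refine h1.congr_deriv ?_
    push_cast
    ring
  obtain ⟨c, hc, hslope⟩ := exists_hasDerivAt_eq_slope _ _ (zero_lt_one' ℝ)
    (fun t _ => (hder t).continuousAt.continuousWithinAt) (fun t _ => hder t)
  have hc' := hC c hc
  rw [inner_sub_right] at hc'
  simp only [one_smul, zero_smul, add_zero, one_mul, zero_mul, one_pow, sub_zero, div_one,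
    mul_one, ne_eq, OfNat.ofNat_ne_zero, not_false_eq_true, zero_pow, mul_zero] at hslope
  linarith

/-- The inner product with a vector supported in a single block only sees that block. -/
lemma PiLp.inner_toLp_single {ι : Type*} [Fintype ι] [DecidableEq ι] {E : ι → Type*}
    [∀ i, NormedAddCommGroup (E i)] [∀ i, InnerProductSpace ℝ (E i)]
    (i : ι) (v : E i) (x : PiLp 2 E) :
    ⟪WithLp.toLp 2 (Pi.single i v), x⟫ = ⟪v, x i⟫ := by
  rw [PiLp.inner_apply, Finset.sum_eq_single i]
  · simp
  · intro j _ hj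
    simp [Pi.single_eq_of_ne hj]
  · simp

/-- Descent lemma along a single block. -/
lemma le_add_inner_gradient_of_block_lipschitz {ι : Type*} [Fintype ι] [DecidableEq ι]
    {E : ι → Type*} [∀ i, NormedAddCommGroup (E i)] [∀ i, InnerProductSpace ℝ (E i)]
    [∀ i, CompleteSpace (E i)] {f : PiLp 2 E → ℝ} (hf : Differentiable ℝ f) {i : ι} {K : ℝ}
    {y : PiLp 2 E}
    (hK : ∀ v : E i,
      ‖gradient f (y + WithLp.toLp 2 (Pi.single i v)) i - gradient f y i‖ ≤ K * ‖v‖)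
    (v : E i) :
    f (y + WithLp.toLp 2 (Pi.single i v)) ≤
      f y + ⟪v, gradient f y i⟫ + K * ‖v‖ ^ 2 / 2 := by
  rw [← PiLp.inner_toLp_single]
  refine le_add_inner_gradient_add_of_inner_gradient_sub_le hf fun t ht => ?_
  rw [PiLp.inner_toLp_single, ← WithLp.toLp_smul, ← Pi.single_smul]
  calc ⟪v, (gradient f (y + WithLp.toLp 2 (Pi.single i (t • v))) - gradient f y) i⟫
      ≤ ‖v‖ * ‖(gradient f (y + WithLp.toLp 2 (Pi.single i (t • v))) - gradient f y) i‖ :=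
        real_inner_le_norm _ _
    _ ≤ ‖v‖ * (K * ‖t • v‖) := mul_le_mul_of_nonneg_left (hK _) (norm_nonneg v)
    _ = K * ‖v‖ ^ 2 * t := by
        rw [norm_smul, Real.norm_of_nonneg ht.1.le]
        ring

/-- **Generalized Descent Lemma.** Let `Φ : ℝ^N → ℝ` be convex and
differentiable on a space decomposed into `n` blocks of dimensions `N_1, …, N_n`
(modelled as the `ℓ²`-product of the block spaces, so that the `i`-th block of a vector
`y` is `y i` and the block embedding `U_i s_i` is `Pi.single i s_i`).  Assume `∇Φ` is
block coordinate-wise Lipschitz continuous with positive constants `L_1, …, L_n`.  Let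
`W = diag(w_1 I, …, w_n I)` with `0 < w_i ≤ 1/(n L_i)`.  Then for all `y, s`,
`Φ(y + s) ≤ Φ(y) + ⟨s, ∇Φ(y)⟩ + (1/2)‖s‖²_{W⁻¹}`, where
`‖s‖²_{W⁻¹} = Σ_i (1/w_i)‖s_i‖²`. -/
theorem generalized_descent_lemma {n : ℕ} (N : Fin n → ℕ)
    (Φ : PiLp 2 (fun i : Fin n => EuclideanSpace ℝ (Fin (N i))) → ℝ)
    (hconvex : ConvexOn ℝ Set.univ Φ)
    (hdiff : Differentiable ℝ Φ)
    (L : Fin n → ℝ) (hLpos : ∀ i, 0 < L i)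
    (hblockLip : ∀ (i : Fin n) (y : PiLp 2 (fun i : Fin n => EuclideanSpace ℝ (Fin (N i))))
        (s : EuclideanSpace ℝ (Fin (N i))),
      ‖gradient Φ (y + (WithLp.equiv 2 _).symm (Pi.single i s)) i - gradient Φ y i‖ ≤
        L i * ‖s‖)
    (w : Fin n → ℝ) (hwpos : ∀ i, 0 < w i) (hwle : ∀ i, w i ≤ 1 / (n * L i)) :
    ∀ y s : PiLp 2 (fun i : Fin n => EuclideanSpace ℝ (Fin (N i))),
      Φ (y + s) ≤ Φ y + ⟪s, gradient Φ y⟫ + (1 / 2) * ∑ i, (1 / w i) * ‖s i‖ ^ 2 := by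
  intro y s
  rcases Nat.eq_zero_or_pos n with rfl | hn
  · have hs : s = 0 := Subsingleton.elim _ _
    simp [hs]
  have hn' : (0 : ℝ) < n := Nat.cast_pos.mpr hn
  have hblock : ∀ i, Φ (y + WithLp.toLp 2 (Pi.single i ((n : ℝ) • s i))) ≤
      Φ y + ⟪(n : ℝ) • s i, gradient Φ y i⟫ + L i * ‖(n : ℝ) • s i‖ ^ 2 / 2 := fun i =>
    le_add_inner_gradient_of_block_lipschitz hdiff (hblockLip i y) _
  have hdecomp :
      ∑ i, (n : ℝ)⁻¹ • (y + WithLp.toLp 2 (Pi.single i ((n : ℝ) • s i))) = y + s := by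
    ext1 j
    simp only [WithLp.ofLp_sum, Finset.sum_apply, PiLp.smul_apply, PiLp.add_apply, smul_add,
      Finset.sum_add_distrib, ← Finset.smul_sum, Finset.sum_pi_single, Finset.mem_univ, if_true]
    simp [smul_smul, ← Nat.cast_smul_eq_nsmul ℝ, hn'.ne']
  have hjensen : Φ (y + s) ≤
      ∑ i, (n : ℝ)⁻¹ * Φ (y + WithLp.toLp 2 (Pi.single i ((n : ℝ) • s i))) := by
    rw [← hdecomp]
    exact hconvex.map_sum_le (fun _ _ => by positivity) (by simp [hn'.ne'])
      (fun _ _ => Set.mem_univ _)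
  have hconst : ∑ _i : Fin n, (n : ℝ)⁻¹ * Φ y = Φ y := by
    simp [hn'.ne']
  calc Φ (y + s)
      ≤ ∑ i, (n : ℝ)⁻¹ * Φ (y + WithLp.toLp 2 (Pi.single i ((n : ℝ) • s i))) := hjensen
    _ ≤ ∑ i, ((n : ℝ)⁻¹ * Φ y + ⟪s i, gradient Φ y i⟫ + 1 / 2 * (1 / w i * ‖s i‖ ^ 2)) := by
        refine Finset.sum_le_sum fun i _ => ?_
        have hw : n * L i ≤ 1 / w i :=
          (le_one_div (hwpos i) (mul_pos hn' (hLpos i))).mp (hwle i)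
        have hi := mul_le_mul_of_nonneg_left (hblock i) (inv_nonneg.mpr hn'.le)
        rw [real_inner_smul_left, norm_smul, Real.norm_of_nonneg hn'.le] at hi
        have hscale : (n : ℝ)⁻¹ * (Φ y + n * ⟪s i, gradient Φ y i⟫ +
            L i * (n * ‖s i‖) ^ 2 / 2) = (n : ℝ)⁻¹ * Φ y + ⟪s i, gradient Φ y i⟫ +
            1 / 2 * (n * L i * ‖s i‖ ^ 2) := by
          field_simp
        rw [hscale] at hi
        have := mul_le_mul_of_nonneg_right hw (sq_nonneg ‖s i‖)
        linarith
    _ = Φ y + ⟪s, gradient Φ y⟫ + (1 / 2) * ∑ i, (1 / w i) * ‖s i‖ ^ 2 := by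
        rw [Finset.sum_add_distrib, Finset.sum_add_distrib, hconst, PiLp.inner_apply,
          Finset.mul_sum]

end
end

section
/- Let Φ : ℝ^N → ℝ be a convex differentiable function whose gradient is block coordinate-wise Lipschitz continuous with positive constants L_1,…,L_n with respect to a block decomposition of ℝ^N into n blocks via matrices U_i (i.e., ‖∇_i Φ(y + U_i s_i) − ∇_i Φ(y)‖ ≤ L_i ‖s_i‖ for all y and s_i, where ∇_i Φ(y) = U_iᵀ ∇Φ(y)). Let Ψ : ℝ^N → ℝ ∪ {+∞} be proper, closed and convex, set Γ := Φ + Ψ, and assume the set of minimizers of Γ is non-empty. Let W be the block-diagonal matrix with i-th diagonal block w_i I_{N_i}, where 0 < w_i ≤ 1/(n L_i). Then the sequence generated by y(t+1) = prox_{W,Ψ}( y(t) − W ∇Φ(y(t)) ) from any initial condition y_0 satisfies, for every minimizer y⋆ of Γ and every t ≥ 1, Γ(y(t)) − Γ(y⋆) ≤ ‖y_0 − y⋆‖²_{W⁻¹} / (2t). -/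
open scoped RealInnerProductSpace BigOperators

noncomputable section

/-- `Ψ` is proper: it never takes the value `-∞` and is not identically `+∞`. -/
def ProperFn {E : Type*} (Ψ : E → EReal) : Prop :=
  (∀ x, Ψ x ≠ ⊥) ∧ ∃ x, Ψ x ≠ ⊤

/-- `Ψ` is convex (as an extended-real-valued function). -/
def ConvexFn {E : Type*} [AddCommGroup E] [Module ℝ E] (Ψ : E → EReal) : Prop :=
  ∀ x y : E, ∀ a b : ℝ, 0 ≤ a → 0 ≤ b → a + b = 1 →
    Ψ (a • x + b • y) ≤ (a : EReal) * Ψ x + (b : EReal) * Ψ y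

/-- `p = prox_{W,Ψ}(v)` for the block-diagonal weight matrix `W = diag(w_1 I, …, w_n I)`:
`p` minimizes `x ↦ Ψ(x) + (1/2)‖x − v‖²_{W⁻¹}`, where
`‖u‖²_{W⁻¹} = Σ_i (1/w_i)‖u_i‖²`. -/
def IsWeightedProxPt {n : ℕ} {N : Fin n → ℕ} (w : Fin n → ℝ)
    (Ψ : PiLp 2 (fun i : Fin n => EuclideanSpace ℝ (Fin (N i))) → EReal)
    (v p : PiLp 2 (fun i : Fin n => EuclideanSpace ℝ (Fin (N i)))) : Prop :=
  ∀ x : PiLp 2 (fun i : Fin n => EuclideanSpace ℝ (Fin (N i))),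
    Ψ p + (((1 / 2) * ∑ i, (1 / w i) * ‖p i - v i‖ ^ 2 : ℝ) : EReal) ≤
      Ψ x + (((1 / 2) * ∑ i, (1 / w i) * ‖x i - v i‖ ^ 2 : ℝ) : EReal)

/-- A function whose directional slope along `d` grows at most linearly satisfies a quadratic
upper bound. -/
lemma le_add_inner_gradient_add_of_slope_le {H : Type*} [NormedAddCommGroup H]
    [InnerProductSpace ℝ H] [CompleteSpace H] {Φ : H → ℝ} (hΦ : Differentiable ℝ Φ) (x d : H)
    {K : ℝ} (hK : ∀ t : ℝ, 0 ≤ t → ⟪gradient Φ (x + t • d) - gradient Φ x, d⟫ ≤ K * t) :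
    Φ (x + d) ≤ Φ x + ⟪gradient Φ x, d⟫ + K / 2 := by
  have hline : ∀ t : ℝ, HasDerivAt (fun t : ℝ => Φ (x + t • d))
      ⟪gradient Φ (x + t • d), d⟫ t := fun t => by
    rw [inner_gradient_left]
    refine (hΦ (x + t • d)).hasFDerivAt.comp_hasDerivAt t ?_
    simpa using ((hasDerivAt_id t).smul_const d).const_add x
  have hder : ∀ t : ℝ, HasDerivAt
      (fun t : ℝ => Φ (x + t • d) - t * ⟪gradient Φ x, d⟫ - K / 2 * t ^ 2)
      (⟪gradient Φ (x + t • d), d⟫ - ⟪gradient Φ x, d⟫ - K * t) t := fun t => by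
    refine (((hline t).sub ((hasDerivAt_id t).mul_const ⟪gradient Φ x, d⟫)).sub
      (((hasDerivAt_id t).pow 2).const_mul (K / 2))).congr_deriv ?_
    simp
    ring
  have hanti : AntitoneOn
      (fun t : ℝ => Φ (x + t • d) - t * ⟪gradient Φ x, d⟫ - K / 2 * t ^ 2) (Set.Ici 0) := by
    refine antitoneOn_of_deriv_nonpos (convex_Ici 0)
      (fun t _ => (hder t).continuousAt.continuousWithinAt)
      (fun t _ => (hder t).differentiableAt.differentiableWithinAt) fun t ht => ?_
    rw [interior_Ici, Set.mem_Ioi] at ht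
    have := hK t ht.le
    rw [inner_sub_left] at this
    rw [(hder t).deriv]
    linarith
  have h01 := hanti (Set.mem_Ici.2 le_rfl) (Set.mem_Ici.2 zero_le_one) zero_le_one
  simp only [one_smul, zero_smul, add_zero] at h01
  linarith

/-- First-order lower bound for a differentiable convex function. -/
lemma ConvexOn.add_inner_gradient_le {H : Type*} [NormedAddCommGroup H]
    [InnerProductSpace ℝ H] [CompleteSpace H] {Φ : H → ℝ} (hconv : ConvexOn ℝ Set.univ Φ)
    (hΦ : Differentiable ℝ Φ) (x z : H) :
    Φ x + ⟪gradient Φ x, z - x⟫ ≤ Φ z := by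
  have hline : HasDerivAt (Φ ∘ AffineMap.lineMap (k := ℝ) x z)
      ⟪gradient Φ x, z - x⟫ 0 := by
    rw [inner_gradient_left]
    have h := (hΦ (AffineMap.lineMap (k := ℝ) x z 0)).hasFDerivAt.comp_hasDerivAt (0 : ℝ)
      (AffineMap.hasDerivAt_lineMap (a := x) (b := z))
    rwa [AffineMap.lineMap_apply_zero] at h
  have h := (hconv.comp_affineMap (AffineMap.lineMap (k := ℝ) x z)).le_slope_of_hasDerivAt
    (Set.mem_univ _) (Set.mem_univ _) zero_lt_one hline
  simp only [slope_def_field, Function.comp_apply, AffineMap.lineMap_apply_one,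
    AffineMap.lineMap_apply_zero, sub_zero, div_one] at h
  linarith

section Blocks

variable {n : ℕ} {F : Fin n → Type*} [∀ i, NormedAddCommGroup (F i)]
  [∀ i, InnerProductSpace ℝ (F i)]

/-- A convex function with block coordinate-wise Lipschitz gradient admits a separable quadratic
upper bound with the block constants scaled by the number of blocks. -/
lemma le_add_inner_gradient_add_of_blockLipschitz [∀ i, CompleteSpace (F i)]
    {Φ : PiLp 2 F → ℝ} (hconv : ConvexOn ℝ Set.univ Φ) (hΦ : Differentiable ℝ Φ) {L : Fin n → ℝ}
    (hL : ∀ (i : Fin n) (y : PiLp 2 F) (s : F i),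
      ‖gradient Φ (y + PiLp.single 2 i s) i - gradient Φ y i‖ ≤ L i * ‖s‖) (y s : PiLp 2 F) :
    Φ (y + s) ≤ Φ y + ⟪gradient Φ y, s⟫ + 1 / 2 * ∑ i, (n * L i) * ‖s i‖ ^ 2 := by
  rcases Nat.eq_zero_or_pos n with rfl | hn
  · have : s = 0 := by ext i; exact i.elim0
    simp [this]
  have hn' : (n : ℝ) ≠ 0 := by positivity
  have inner_single : ∀ (g : PiLp 2 F) (i : Fin n) (a : F i),
      ⟪g, PiLp.single 2 i a⟫ = ⟪g i, a⟫ := fun g i a => by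
    rw [PiLp.inner_apply, Finset.sum_eq_single i]
    · simp
    · intro j _ hj
      simp [hj]
    · simp
  have hblock : ∀ i, Φ (y + PiLp.single 2 i ((n : ℝ) • s i)) ≤
      Φ y + n * ⟪gradient Φ y i, s i⟫ + L i * (n ^ 2 * ‖s i‖ ^ 2) / 2 := fun i => by
    have h := le_add_inner_gradient_add_of_slope_le hΦ y (PiLp.single 2 i ((n : ℝ) • s i))
      (K := L i * (n ^ 2 * ‖s i‖ ^ 2)) fun t ht => by
        have hsm : t • PiLp.single 2 i ((n : ℝ) • s i) =
            (PiLp.single 2 i (t • (n : ℝ) • s i) : PiLp 2 F) := by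
          ext j
          rcases eq_or_ne j i with rfl | hj
          · simp
          · simp [hj]
        rw [hsm, inner_single]
        refine (real_inner_le_norm _ _).trans ?_
        refine (mul_le_mul_of_nonneg_right (hL i y _) (norm_nonneg _)).trans_eq ?_
        simp only [norm_smul, Real.norm_eq_abs, abs_of_nonneg ht, Nat.abs_cast]
        ring
    rwa [inner_single, inner_smul_right] at h
  have havg : y + s = ∑ i : Fin n, (1 / n : ℝ) • (y + PiLp.single 2 i ((n : ℝ) • s i)) := by
    simp only [smul_add, Finset.sum_add_distrib, Finset.sum_const, Finset.card_univ,
      Fintype.card_fin]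
    congr 1
    · rw [← Nat.cast_smul_eq_nsmul ℝ, smul_smul, mul_one_div_cancel hn', one_smul]
    · ext j
      rw [WithLp.ofLp_sum, Finset.sum_apply, Finset.sum_eq_single j]
      · simp [smul_smul, hn']
      · intro i _ hij
        simp [hij.symm]
      · simp
  have hjensen := hconv.map_sum_le (t := Finset.univ) (w := fun _ : Fin n => (1 / n : ℝ))
    (p := fun i => y + PiLp.single 2 i ((n : ℝ) • s i)) (fun _ _ => by positivity)
    (by simp [hn']) (fun _ _ => Set.mem_univ _)
  rw [← havg] at hjensen
  refine hjensen.trans ((Finset.sum_le_sum fun i _ =>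
    smul_le_smul_of_nonneg_left (hblock i) (by positivity)).trans_eq ?_)
  have hterm : ∀ i : Fin n, (1 / n : ℝ) •
      (Φ y + n * ⟪gradient Φ y i, s i⟫ + L i * (n ^ 2 * ‖s i‖ ^ 2) / 2) =
      1 / n * Φ y + ⟪gradient Φ y i, s i⟫ + 1 / 2 * ((n * L i) * ‖s i‖ ^ 2) := fun i => by
    rw [smul_eq_mul]
    field_simp
  simp only [hterm, Finset.sum_add_distrib, ← Finset.mul_sum, Finset.sum_const, Finset.card_univ,
    Fintype.card_fin, nsmul_eq_mul, PiLp.inner_apply]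
  field_simp

end Blocks

/-- Variational inequality satisfied by a weighted proximal point of a convex function. -/
lemma IsWeightedProxPt.le_add_sum_inner {n : ℕ} {N : Fin n → ℕ} {w : Fin n → ℝ}
    {Ψ : PiLp 2 (fun i : Fin n => EuclideanSpace ℝ (Fin (N i))) → EReal} (hΨ : ConvexFn Ψ)
    {v p x : PiLp 2 (fun i : Fin n => EuclideanSpace ℝ (Fin (N i)))}
    (hp : IsWeightedProxPt w Ψ v p) {a b : ℝ} (hpa : Ψ p = a) (hxb : Ψ x = b) :
    a ≤ b + ∑ i, (1 / w i) * ⟪p i - v i, x i - p i⟫ := by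
  have hstep : ∀ θ : ℝ, 0 < θ → θ ≤ 1 →
      a ≤ b + ∑ i, (1 / w i) * ⟪p i - v i, x i - p i⟫ +
        θ * (1 / 2 * ∑ i, (1 / w i) * ‖x i - p i‖ ^ 2) := fun θ hθ hθ1 => by
    have h1 := hp ((1 - θ) • p + θ • x)
    have h2 := hΨ p x (1 - θ) θ (by linarith) hθ.le (by ring)
    have h3 := h1.trans (add_le_add_left h2 _)
    rw [hpa, hxb] at h3
    norm_cast at h3
    have hexp : ∑ i, (1 / w i) * ‖((1 - θ) • p + θ • x) i - v i‖ ^ 2 =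
        ∑ i, (1 / w i) * ‖p i - v i‖ ^ 2 +
        2 * θ * ∑ i, (1 / w i) * ⟪p i - v i, x i - p i⟫ +
        θ ^ 2 * ∑ i, (1 / w i) * ‖x i - p i‖ ^ 2 := by
      simp only [Finset.mul_sum, ← Finset.sum_add_distrib]
      refine Finset.sum_congr rfl fun i _ => ?_
      have : ((1 - θ) • p + θ • x) i - v i = (p i - v i) + θ • (x i - p i) := by
        simp only [PiLp.add_apply, PiLp.smul_apply]
        module
      rw [this, norm_add_sq_real, inner_smul_right, norm_smul, mul_pow, Real.norm_eq_abs, sq_abs]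
      ring
    rw [hexp] at h3
    refine le_of_mul_le_mul_left ?_ hθ
    linarith
  refine ge_of_tendsto (x := nhdsWithin (0 : ℝ) (Set.Ioi 0)) (f := fun θ : ℝ =>
      b + ∑ i, (1 / w i) * ⟪p i - v i, x i - p i⟫ +
        θ * (1 / 2 * ∑ i, (1 / w i) * ‖x i - p i‖ ^ 2)) ?_ ?_
  · refine tendsto_nhdsWithin_of_tendsto_nhds (Continuous.tendsto' (by fun_prop) _ _ (by simp))
  · filter_upwards [Ioc_mem_nhdsGT (zero_lt_one (α := ℝ))] with θ hθ using hstep θ hθ.1 hθ.2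

/-- One step of the weighted proximal gradient method: three-point inequality. -/
lemma IsWeightedProxPt.forward_backward_le {n : ℕ} {N : Fin n → ℕ}
    {Φ : PiLp 2 (fun i : Fin n => EuclideanSpace ℝ (Fin (N i))) → ℝ}
    (hconvex : ConvexOn ℝ Set.univ Φ) (hdiff : Differentiable ℝ Φ)
    {L : Fin n → ℝ} (hLpos : ∀ i, 0 < L i)
    (hL : ∀ (i : Fin n) (y : PiLp 2 (fun i : Fin n => EuclideanSpace ℝ (Fin (N i))))
        (s : EuclideanSpace ℝ (Fin (N i))),
      ‖gradient Φ (y + PiLp.single 2 i s) i - gradient Φ y i‖ ≤ L i * ‖s‖)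
    {Ψ : PiLp 2 (fun i : Fin n => EuclideanSpace ℝ (Fin (N i))) → EReal} (hΨ : ConvexFn Ψ)
    {w : Fin n → ℝ} (hwpos : ∀ i, 0 < w i) (hwle : ∀ i, w i ≤ 1 / (n * L i))
    {y p x : PiLp 2 (fun i : Fin n => EuclideanSpace ℝ (Fin (N i)))}
    (hp : IsWeightedProxPt w Ψ (y - WithLp.toLp 2 (fun i => w i • gradient Φ y i)) p)
    {a b : ℝ} (hpa : Ψ p = a) (hxb : Ψ x = b) :
    Φ p + a + 1 / 2 * ∑ i, (1 / w i) * ‖p i - x i‖ ^ 2 ≤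
      Φ x + b + 1 / 2 * ∑ i, (1 / w i) * ‖y i - x i‖ ^ 2 := by
  have hprox := hp.le_add_sum_inner hΨ hpa hxb
  have hlower := hconvex.add_inner_gradient_le hdiff y x
  have hupper := le_add_inner_gradient_add_of_blockLipschitz hconvex hdiff hL y (p - y)
  rw [add_sub_cancel] at hupper
  have hweights : ∑ i, (n * L i) * ‖(p - y) i‖ ^ 2 ≤ ∑ i, (1 / w i) * ‖p i - y i‖ ^ 2 := by
    refine Finset.sum_le_sum fun i _ => mul_le_mul_of_nonneg_right ?_ (sq_nonneg _)
    have hn : (0 : ℝ) < n := Nat.cast_pos.2 i.pos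
    exact (le_one_div (hwpos i) (mul_pos hn (hLpos i))).1 (hwle i)
  have hsplit : ∑ i, (1 / w i) *
      ⟪p i - (y - WithLp.toLp 2 (fun i => w i • gradient Φ y i)) i, x i - p i⟫ =
      1 / 2 * ∑ i, (1 / w i) * ‖y i - x i‖ ^ 2 - 1 / 2 * ∑ i, (1 / w i) * ‖p i - x i‖ ^ 2 -
      1 / 2 * ∑ i, (1 / w i) * ‖p i - y i‖ ^ 2 +
      (⟪gradient Φ y, x - y⟫ - ⟪gradient Φ y, p - y⟫) := by
    rw [← inner_sub_right, sub_sub_sub_cancel_right, PiLp.inner_apply]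
    simp only [Finset.mul_sum, ← Finset.sum_add_distrib, ← Finset.sum_sub_distrib]
    refine Finset.sum_congr rfl fun i _ => ?_
    have hw := (hwpos i).ne'
    have h1 : p i - (y - WithLp.toLp 2 (fun i => w i • gradient Φ y i)) i =
        (p i - y i) + w i • gradient Φ y i := by
      simp only [PiLp.sub_apply]
      abel
    have h2 : y i - x i = -((p i - y i) + (x i - p i)) := by abel
    rw [h1, inner_add_left, real_inner_smul_left, h2, norm_neg, norm_add_sq_real,
      norm_sub_rev (p i) (x i), PiLp.sub_apply]
    field_simp
    ring
  linarith

/-- **Weighted proximal gradient: `O(1/t)` rate.** Let `Φ` be convex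
differentiable with block coordinate-wise Lipschitz gradient (constants `L_i`), `Ψ`
proper, closed and convex, `Γ := Φ + Ψ` with a non-empty set of minimizers, and let
`W = diag(w_1 I, …, w_n I)` with `0 < w_i ≤ 1/(n L_i)`.  Then the sequence
`y(t+1) = prox_{W,Ψ}(y(t) − W ∇Φ(y(t)))` satisfies, for every minimizer `y⋆` and `t ≥ 1`,
`Γ(y(t)) − Γ(y⋆) ≤ ‖y(0) − y⋆‖²_{W⁻¹}/(2t)`. -/
theorem weighted_proximal_gradient_rate {n : ℕ} (N : Fin n → ℕ)
    (Φ : PiLp 2 (fun i : Fin n => EuclideanSpace ℝ (Fin (N i))) → ℝ)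
    (hconvex : ConvexOn ℝ Set.univ Φ)
    (hdiff : Differentiable ℝ Φ)
    (L : Fin n → ℝ) (hLpos : ∀ i, 0 < L i)
    (hblockLip : ∀ (i : Fin n) (y : PiLp 2 (fun i : Fin n => EuclideanSpace ℝ (Fin (N i))))
        (s : EuclideanSpace ℝ (Fin (N i))),
      ‖gradient Φ (y + (WithLp.equiv 2 _).symm (Pi.single i s)) i - gradient Φ y i‖ ≤
        L i * ‖s‖)
    (Ψ : PiLp 2 (fun i : Fin n => EuclideanSpace ℝ (Fin (N i))) → EReal)
    (hproper : ProperFn Ψ) (hclosedΨ : LowerSemicontinuous Ψ) (hconvexΨ : ConvexFn Ψ)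
    (hminimizers : ∃ ys : PiLp 2 (fun i : Fin n => EuclideanSpace ℝ (Fin (N i))),
      ∀ z, (Φ ys : EReal) + Ψ ys ≤ (Φ z : EReal) + Ψ z)
    (w : Fin n → ℝ) (hwpos : ∀ i, 0 < w i) (hwle : ∀ i, w i ≤ 1 / (n * L i))
    (y : ℕ → PiLp 2 (fun i : Fin n => EuclideanSpace ℝ (Fin (N i))))
    (hupdate : ∀ t : ℕ, IsWeightedProxPt w Ψ
      (y t - (WithLp.equiv 2 _).symm (fun i => w i • gradient Φ (y t) i)) (y (t + 1))) :
    ∀ ystar : PiLp 2 (fun i : Fin n => EuclideanSpace ℝ (Fin (N i))),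
      (∀ z, (Φ ystar : EReal) + Ψ ystar ≤ (Φ z : EReal) + Ψ z) →
      ∀ t : ℕ, 1 ≤ t →
        ((Φ (y t) : EReal) + Ψ (y t)) - ((Φ ystar : EReal) + Ψ ystar) ≤
          (((∑ i, (1 / w i) * ‖y 0 i - ystar i‖ ^ 2) / (2 * t) : ℝ) : EReal) := by
  intro ystar hstar
  have hreal : ∀ {x}, Ψ x ≠ ⊤ → Ψ x = ((Ψ x).toReal : EReal) := fun hx =>
    (EReal.coe_toReal hx (hproper.1 _)).symm
  obtain ⟨x₀, hx₀⟩ := hproper.2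
  have hstar_top : Ψ ystar ≠ ⊤ := fun h => by
    have h0 := hstar x₀
    rw [h, hreal hx₀, EReal.coe_add_top, ← EReal.coe_add, top_le_iff] at h0
    exact EReal.coe_ne_top _ h0
  have hiter_top : ∀ t, Ψ (y (t + 1)) ≠ ⊤ := fun t h => by
    have h0 := hupdate t x₀
    rw [h, hreal hx₀, EReal.top_add_coe, ← EReal.coe_add, top_le_iff] at h0
    exact EReal.coe_ne_top _ h0
  have hstep : ∀ t {x}, Ψ x ≠ ⊤ →
      Φ (y (t + 1)) + (Ψ (y (t + 1))).toReal +
        1 / 2 * ∑ i, (1 / w i) * ‖y (t + 1) i - x i‖ ^ 2 ≤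
      Φ x + (Ψ x).toReal + 1 / 2 * ∑ i, (1 / w i) * ‖y t i - x i‖ ^ 2 := fun t x hx =>
    (hupdate t).forward_backward_le hconvex hdiff hLpos hblockLip hconvexΨ hwpos hwle
      (hreal (hiter_top t)) (hreal hx)
  have hrate : ∀ t : ℕ, ((t + 1 : ℕ) : ℝ) * (Φ (y (t + 1)) + (Ψ (y (t + 1))).toReal -
        (Φ ystar + (Ψ ystar).toReal)) +
        1 / 2 * ∑ i, (1 / w i) * ‖y (t + 1) i - ystar i‖ ^ 2 ≤
      1 / 2 * ∑ i, (1 / w i) * ‖y 0 i - ystar i‖ ^ 2 := fun t => by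
    induction t with
    | zero =>
      have h := hstep 0 hstar_top
      rw [zero_add, Nat.cast_one] at *
      linarith
    | succ t ih =>
      have h := hstep (t + 1) hstar_top
      have hdecr := hstep (t + 1) (hiter_top t)
      have hnonneg : 0 ≤ ∑ i, (1 / w i) * ‖y (t + 1 + 1) i - y (t + 1) i‖ ^ 2 :=
        Finset.sum_nonneg fun i _ =>
          mul_nonneg (one_div_nonneg.2 (hwpos i).le) (sq_nonneg _)
      simp only [sub_self, norm_zero, ne_eq, OfNat.ofNat_ne_zero, not_false_eq_true, zero_pow,
        mul_zero, Finset.sum_const_zero, add_zero] at hdecr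
      have hmono := mul_le_mul_of_nonneg_left
        (show Φ (y (t + 1 + 1)) + (Ψ (y (t + 1 + 1))).toReal ≤
          Φ (y (t + 1)) + (Ψ (y (t + 1))).toReal by linarith) (Nat.cast_nonneg (α := ℝ) (t + 1))
      rw [Nat.cast_succ (t + 1)]
      linarith
  intro t ht
  obtain ⟨t, rfl⟩ := Nat.exists_eq_add_of_le' ht
  rw [hreal (hiter_top t), hreal hstar_top]
  norm_cast
  have hnonneg : 0 ≤ ∑ i, (1 / w i) * ‖y (t + 1) i - ystar i‖ ^ 2 :=
    Finset.sum_nonneg fun i _ => mul_nonneg (one_div_nonneg.2 (hwpos i).le) (sq_nonneg _)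
  rw [le_div_iff₀ (by positivity)]
  have := hrate t
  push_cast at this ⊢
  linarith

end
end
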